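/- Let L be an orthomodular lattice, p ∈ L, and L^◇ a modal extension of L. Then the set of classical consequences of p satisfies Cons_{L^◇}(p) = {x ∈ ◇L : p ≤ x} = {x ∈ ◇L : ◇p ≤ x}. -/

import Mathlib

/-! Basic notions: orthomodular lattices, central elements, Boolean saturation,
modal extensions and possibility spaces. -/

/-- An orthomodular lattice: a bounded lattice with an involution `neg`
satisfying `x ⊓ neg x = ⊥` and the orthomodular law. -/
class OML (α : Type u) extends Lattice α, BoundedOrder α where
  neg : α → α
  neg_neg : ∀ x : α, neg (neg x) = x
  neg_sup : ∀ x y : α, neg (x ⊔ y) = neg x ⊓ neg y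
  inf_neg : ∀ x : α, x ⊓ neg x = ⊥
  orthomodular : ∀ x y : α, x ⊔ (neg x ⊓ (x ⊔ y)) = x ⊔ y

namespace OML

variable {α : Type u} [OML α]

/-- `(a,b,c)D` -/
def D (a b c : α) : Prop := (a ⊔ b) ⊓ c = (a ⊓ c) ⊔ (b ⊓ c)

/-- `(a,b,c)D*` -/
def Dstar (a b c : α) : Prop := (a ⊓ b) ⊔ c = (a ⊔ c) ⊓ (b ⊔ c)

/-- A central element: complemented and all permuted distributivity
conditions hold. -/
def IsCentral (z : α) : Prop :=
  (∃ c : α, z ⊓ c = ⊥ ∧ z ⊔ c = ⊤) ∧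
    ∀ a b : α, D a b z ∧ D a z b ∧ D z a b ∧ Dstar a b z ∧ Dstar a z b ∧ Dstar z a b

end OML

/-- `dia` is the possibility operator: `dia a` is the least central element above `a`. -/
def IsDiamond {α : Type u} [OML α] (dia : α → α) : Prop :=
  ∀ a : α, IsLeast {z : α | OML.IsCentral z ∧ a ≤ z} (dia a)

/-- A Boolean saturated orthomodular lattice: every `{z ∈ Z(L) : a ≤ z}` has a minimum. -/
def BooleanSaturated (α : Type u) [OML α] : Prop :=
  ∀ a : α, ∃ m : α, IsLeast {z : α | OML.IsCentral z ∧ a ≤ z} m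

/-- A Boolean sublattice: a sublattice containing `⊥, ⊤`, closed under `neg`,
and distributive. -/
structure IsBooleanSub {α : Type u} [OML α] (S : Set α) : Prop where
  bot_mem : (⊥ : α) ∈ S
  top_mem : (⊤ : α) ∈ S
  inf_mem : ∀ x ∈ S, ∀ y ∈ S, x ⊓ y ∈ S
  sup_mem : ∀ x ∈ S, ∀ y ∈ S, x ⊔ y ∈ S
  neg_mem : ∀ x ∈ S, OML.neg x ∈ S
  distrib : ∀ x ∈ S, ∀ y ∈ S, ∀ z ∈ S, x ⊓ (y ⊔ z) = (x ⊓ y) ⊔ (x ⊓ z)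

/-- A Boolean homomorphism into the two-element Boolean algebra `Bool`,
defined on the subset `S`. -/
def IsBoolHomOn {α : Type u} [OML α] (S : Set α) (v : α → Bool) : Prop :=
  v ⊥ = false ∧ v ⊤ = true ∧
    (∀ x ∈ S, ∀ y ∈ S, v (x ⊓ y) = (v x && v y)) ∧
    (∀ x ∈ S, ∀ y ∈ S, v (x ⊔ y) = (v x || v y)) ∧
    (∀ x ∈ S, v (OML.neg x) = !(v x))

/-- Membership in the sublattice generated by `X`. -/
inductive GenSub {α : Type u} [OML α] (X : Set α) : α → Prop
  | base : ∀ x ∈ X, GenSub X x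
  | inf : ∀ x y, GenSub X x → GenSub X y → GenSub X (x ⊓ y)
  | sup : ∀ x y, GenSub X x → GenSub X y → GenSub X (x ⊔ y)

/-- The embedding of a modal extension: injective and preserving `⊓, ⊔, neg, ⊥, ⊤`. -/
def IsOMLEmbedding {α : Type u} {β : Type v} [OML α] [OML β] (e : α → β) : Prop :=
  Function.Injective e ∧ e ⊥ = ⊥ ∧ e ⊤ = ⊤ ∧
    (∀ x y : α, e (x ⊓ y) = e x ⊓ e y) ∧
    (∀ x y : α, e (x ⊔ y) = e x ⊔ e y) ∧
    (∀ x : α, e (OML.neg x) = OML.neg (e x))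

/-- The possibility space `◇L`: the sublattice of `L^◇` generated by `{◇p : p ∈ L}`. -/
def PossSpace {α : Type u} {β : Type v} [OML α] [OML β] (e : α → β) (dia : β → β) : Set β :=
  {x : β | GenSub (Set.range fun p : α => dia (e p)) x}

/-- A global valuation: a compatible family of Boolean homomorphisms into `2`,
indexed by the Boolean sublattices. -/
def HasGlobalValuation (α : Type u) [OML α] : Prop :=
  ∃ v : Set α → α → Bool,
    (∀ W : Set α, IsBooleanSub W → IsBoolHomOn W (v W)) ∧
    (∀ W W' : Set α, IsBooleanSub W → IsBooleanSub W' → ∀ x ∈ W ∩ W', v W x = v W' x)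
namespace OML

variable {α : Type u} [OML α]

theorem neg_inf (x y : α) : neg (x ⊓ y) = neg x ⊔ neg y := by
  rw [← neg_neg (neg x ⊔ neg y), neg_sup, neg_neg, neg_neg]

theorem neg_le_neg {x y : α} (h : x ≤ y) : neg y ≤ neg x := by
  rw [← inf_eq_right, ← neg_sup, sup_eq_right.2 h]

theorem neg_bot : neg (⊥ : α) = ⊤ := by
  have h : neg (⊤ : α) ≤ ⊥ := by simpa using (inf_neg (⊤ : α)).le
  rw [← neg_neg (⊤ : α), le_bot_iff.1 h]

theorem neg_top : neg (⊤ : α) = ⊥ := by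
  rw [← neg_bot, neg_neg]

theorem sup_neg (x : α) : x ⊔ neg x = ⊤ := by
  rw [← neg_neg (x ⊔ neg x), neg_sup, inf_neg, neg_bot]

/-- If `s ≤ z` and `t ≤ neg z`, then the `z`-part of `s ⊔ t` is `s`. -/
theorem sup_inf_le_of_le_of_le_neg {s t z : α} (hs : s ≤ z) (ht : t ≤ neg z) :
    (s ⊔ t) ⊓ z ≤ s := by
  have hst : s ≤ neg t := hs.trans (by simpa [neg_neg] using neg_le_neg ht)
  have h1 : neg s ⊓ (s ⊔ t) = t := by
    have h := orthomodular s (neg t)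
    rw [sup_eq_right.2 hst] at h
    have h' := congrArg neg h
    rwa [neg_sup, neg_inf, neg_neg, neg_neg] at h'
  have h2 := orthomodular s ((s ⊔ t) ⊓ z)
  have hsu : s ≤ (s ⊔ t) ⊓ z := le_inf le_sup_left hs
  rw [sup_eq_right.2 hsu, ← inf_assoc, h1] at h2
  rw [← h2]
  refine sup_le le_rfl (le_trans ?_ bot_le)
  rw [← inf_neg z, inf_comm]
  exact inf_le_inf_left z ht

/-- `z` splits every element into its parts below `z` and below `neg z`. -/
def Splits (z : α) : Prop := ∀ b : α, b ≤ (b ⊓ z) ⊔ (b ⊓ neg z)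

theorem Splits.neg {z : α} (hz : Splits z) : Splits (neg z) := fun b => by
  rw [neg_neg, sup_comm]; exact hz b

theorem Splits.inf {z w : α} (hz : Splits z) (hw : Splits w) : Splits (z ⊓ w) := fun b => by
  refine (hz b).trans (sup_le ((hw _).trans (sup_le ?_ ?_)) ?_)
  · rw [inf_assoc]; exact le_sup_left
  · refine le_sup_of_le_right (inf_le_inf inf_le_left ?_)
    rw [neg_inf]; exact le_sup_right
  · refine le_sup_of_le_right (inf_le_inf_left b ?_)
    rw [neg_inf]; exact le_sup_left

theorem Splits.sup {z w : α} (hz : Splits z) (hw : Splits w) : Splits (z ⊔ w) := by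
  simpa [neg_inf, neg_neg] using (hz.neg.inf hw.neg).neg

theorem splits_top : Splits (⊤ : α) := fun b => by simp

theorem Splits.sup_inf_le {z : α} (hz : Splits z) (a b : α) :
    (a ⊔ b) ⊓ z ≤ (a ⊓ z) ⊔ (b ⊓ z) := by
  have h : a ⊔ b ≤ ((a ⊓ z) ⊔ (b ⊓ z)) ⊔ ((a ⊓ OML.neg z) ⊔ (b ⊓ OML.neg z)) := by
    rw [sup_sup_sup_comm]; exact sup_le_sup (hz a) (hz b)
  exact (inf_le_inf_right z h).trans (sup_inf_le_of_le_of_le_neg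
    (sup_le inf_le_right inf_le_right) (sup_le inf_le_right inf_le_right))

theorem Splits.D_right {z : α} (hz : Splits z) (a b : α) : D a b z :=
  (hz.sup_inf_le a b).antisymm
    (sup_le (inf_le_inf_right z le_sup_left) (inf_le_inf_right z le_sup_right))

theorem Splits.D_mid {z : α} (hz : Splits z) (a b : α) : D a z b := by
  refine le_antisymm ((hz _).trans (sup_le ?_ ?_))
    (sup_le (inf_le_inf_right b le_sup_left) (inf_le_inf_right b le_sup_right))
  · exact le_sup_of_le_right (le_inf inf_le_right (inf_le_left.trans inf_le_right))
  · refine le_sup_of_le_left (le_inf ?_ (inf_le_left.trans inf_le_right))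
    refine (inf_le_inf_right _ inf_le_left).trans ((hz.neg.sup_inf_le a z).trans ?_)
    rw [inf_neg]
    exact sup_le inf_le_left bot_le

theorem Splits.D_left {z : α} (hz : Splits z) (a b : α) : D z a b := by
  have h := hz.D_mid a b
  unfold D at h ⊢
  rw [sup_comm, h, sup_comm]

theorem Dstar_of_D_neg {a b c : α} (h : D (neg a) (neg b) (neg c)) : Dstar a b c := by
  have h' := congrArg neg h
  rwa [neg_inf, neg_sup, neg_sup, neg_inf, neg_inf, neg_neg, neg_neg, neg_neg] at h'

theorem Splits.isCentral {z : α} (hz : Splits z) : IsCentral z :=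
  ⟨⟨OML.neg z, inf_neg z, sup_neg z⟩, fun a b =>
    ⟨hz.D_right a b, hz.D_mid a b, hz.D_left a b, Dstar_of_D_neg (hz.neg.D_right _ _),
      Dstar_of_D_neg (hz.neg.D_mid _ _), Dstar_of_D_neg (hz.neg.D_left _ _)⟩⟩

theorem IsCentral.splits {z : α} (hz : IsCentral z) : Splits z := fun b => by
  have h : (z ⊔ neg z) ⊓ b = (z ⊓ b) ⊔ (neg z ⊓ b) := (hz.2 (neg z) b).2.2.1
  rw [sup_neg, top_inf_eq, inf_comm z, inf_comm (neg z)] at h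
  exact h.le

variable (α) in
/-- The sublattice of splitting elements, i.e. the center. -/
def center : Sublattice α where
  carrier := {z | Splits z}
  supClosed' := fun _ hz _ hw => hz.sup hw
  infClosed' := fun _ hz _ hw => hz.inf hw

instance : DistribLattice (center α) :=
  DistribLattice.ofInfSupLe fun x y z => by
    have h := z.2.D_mid (y : α) (x : α)
    change (x : α) ⊓ (y ⊔ z) ≤ (x ⊓ y) ⊔ (x ⊓ z)
    rw [inf_comm, h, inf_comm (y : α), inf_comm (z : α)]
    exact le_rfl

instance : BoundedOrder (center α) where
  top := ⟨⊤, splits_top⟩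
  le_top x := (le_top : (x : α) ≤ ⊤)
  bot := ⟨⊥, neg_top (α := α) ▸ splits_top.neg⟩
  bot_le x := (bot_le : ⊥ ≤ (x : α))

/-- If `a` is not below `x`, some ultrafilter of the center has no member `z` with
`z ⊓ a ≤ x`. -/
theorem exists_ultrafilter_center {a x : α} (hax : ¬ a ≤ x) :
    ∃ F : Set α, (∀ z ∈ F, ∀ w ∈ F, z ⊓ w ∈ F) ∧
      (∀ z, Splits z → z ∈ F ∨ neg z ∈ F) ∧ ⊤ ∈ F ∧ ∀ z ∈ F, ¬ z ⊓ a ≤ x := by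
  let I : Order.Ideal (center α) :=
    { carrier := {z | (z : α) ⊓ a ≤ x}
      lower' := fun z w hwz hz => (inf_le_inf_right a hwz).trans hz
      nonempty' := ⟨⊥, (inf_le_left.trans bot_le : (⊥ : α) ⊓ a ≤ x)⟩
      directed' := fun z hz w hw =>
        ⟨z ⊔ w, (w.2.D_mid (z : α) a).trans_le (sup_le hz hw), le_sup_left, le_sup_right⟩ }
  have hdisj : Disjoint (Order.PFilter.principal (⊤ : center α) : Set (center α))
      (I : Set (center α)) := by
    rw [Set.disjoint_left]
    rintro z hz hzI
    have hz' : (⊤ : α) ≤ z := hz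
    have hzI' : (z : α) ⊓ a ≤ x := hzI
    rw [top_le_iff.1 hz', top_inf_eq] at hzI'
    exact hax hzI'
  obtain ⟨J, hJ, hIJ, hFJ⟩ := DistribLattice.prime_ideal_of_disjoint_filter_ideal hdisj
  have htop : (⊤ : center α) ∉ J := Set.disjoint_left.1 hFJ (le_refl (⊤ : center α))
  refine ⟨{z | ∃ h : Splits z, (⟨z, h⟩ : center α) ∉ J}, ?_, ?_,
    ⟨splits_top, htop⟩, ?_⟩
  · rintro z ⟨hz, hzJ⟩ w ⟨hw, hwJ⟩
    refine ⟨hz.inf hw, fun h => ?_⟩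
    exact (hJ.mem_or_mem (x := ⟨z, hz⟩) (y := ⟨w, hw⟩) h).elim hzJ hwJ
  · intro z hz
    by_contra! h
    have h1 : (⟨z, hz⟩ : center α) ∈ J := by
      by_contra h1; exact h.1 ⟨hz, h1⟩
    have h2 : (⟨neg z, hz.neg⟩ : center α) ∈ J := by
      by_contra h2; exact h.2 ⟨hz.neg, h2⟩
    refine htop (J.lower ?_ (Order.Ideal.sup_mem h1 h2))
    exact (sup_neg z).ge
  · rintro z ⟨hz, hzJ⟩ h
    exact hzJ (hIJ h)

/-- `y` agrees below `a` with some central element. -/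
def CentralBelow (a y : α) : Prop := ∃ z : α, Splits z ∧ z ⊓ a ≤ y ∧ neg z ⊓ a ≤ neg y

theorem Splits.centralBelow {z : α} (hz : Splits z) (a : α) : CentralBelow a z :=
  ⟨z, hz, inf_le_left, inf_le_left⟩

theorem centralBelow_self (a : α) : CentralBelow a a :=
  ⟨⊤, splits_top, inf_le_right, by rw [neg_top]; exact inf_le_left.trans bot_le⟩

theorem CentralBelow.neg {a y : α} : CentralBelow a y → CentralBelow a (neg y) :=
  fun ⟨z, hz, h1, h2⟩ => ⟨OML.neg z, hz.neg, h2, by rwa [neg_neg, neg_neg]⟩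

theorem CentralBelow.inf {a x y : α} :
    CentralBelow a x → CentralBelow a y → CentralBelow a (x ⊓ y) := by
  rintro ⟨z, hz, h1, h2⟩ ⟨w, hw, h3, h4⟩
  refine ⟨z ⊓ w, hz.inf hw, le_inf ((inf_le_inf_right a inf_le_left).trans h1)
    ((inf_le_inf_right a inf_le_right).trans h3), ?_⟩
  rw [neg_inf, neg_inf, hw.neg.D_mid (OML.neg z) a]
  exact sup_le_sup h2 h4

theorem CentralBelow.sup {a x y : α} (hx : CentralBelow a x) (hy : CentralBelow a y) :
    CentralBelow a (x ⊔ y) := by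
  simpa [neg_inf, neg_neg] using (hx.neg.inf hy.neg).neg

/-- If `a` is not below `x`, some valuation makes `a` true and `x` false. -/
theorem exists_valuation {a x : α} (hax : ¬ a ≤ x) :
    ∃ v : α → Bool, IsBoolHomOn {y | CentralBelow a y} v ∧ v a = true ∧ v x = false := by
  classical
  obtain ⟨F, hinf, hultra, htop, hF⟩ := exists_ultrafilter_center hax
  let P : α → Prop := fun y => ∃ z ∈ F, z ⊓ a ≤ y
  have hPinf : ∀ y w, P (y ⊓ w) ↔ P y ∧ P w := fun y w =>
    ⟨fun ⟨z, hz, h⟩ => ⟨⟨z, hz, h.trans inf_le_left⟩, ⟨z, hz, h.trans inf_le_right⟩⟩,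
      fun ⟨⟨z, hz, h⟩, ⟨z', hz', h'⟩⟩ => ⟨z ⊓ z', hinf z hz z' hz',
        le_inf ((inf_le_inf_right a inf_le_left).trans h)
          ((inf_le_inf_right a inf_le_right).trans h')⟩⟩
  have hPbot : ¬ P ⊥ := fun ⟨z, hz, h⟩ => hF z hz (h.trans bot_le)
  have hPneg : ∀ y, CentralBelow a y → (P (neg y) ↔ ¬ P y) := by
    rintro y ⟨z, hz, h1, h2⟩
    refine ⟨fun h h' => hPbot ?_, fun h => ?_⟩
    · rw [← inf_neg y]; exact (hPinf _ _).2 ⟨h', h⟩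
    · rcases hultra z hz with hzF | hzF
      · exact (h ⟨z, hzF, h1⟩).elim
      · exact ⟨neg z, hzF, h2⟩
  have hPsup : ∀ y, CentralBelow a y → ∀ w, CentralBelow a w → (P (y ⊔ w) ↔ P y ∨ P w) := by
    intro y hy w hw
    have h := hPneg _ (hy.neg.inf hw.neg)
    rw [neg_inf, neg_neg, neg_neg, hPinf, hPneg y hy, hPneg w hw] at h
    rw [h, not_and_or, not_not, not_not]
  refine ⟨fun y => decide (P y), ⟨?_, ?_, ?_, ?_, ?_⟩, ?_, ?_⟩
  · exact decide_eq_false hPbot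
  · exact decide_eq_true ⟨⊤, htop, le_top⟩
  · intro y _ w _
    simp [hPinf]
  · intro y hy w hw
    simp [hPsup y hy w hw]
  · intro y hy
    simp [hPneg y hy]
  · exact decide_eq_true ⟨⊤, htop, inf_le_right⟩
  · exact decide_eq_false fun ⟨z, hz, h⟩ => hF z hz h

/-- The four-element Boolean sublattice generated by `p`. -/
theorem isBooleanSub_four (p : α) : IsBooleanSub ({⊥, ⊤, p, neg p} : Set α) where
  bot_mem := by simp
  top_mem := by simp
  inf_mem := by
    rintro x (rfl | rfl | rfl | rfl) y (rfl | rfl | rfl | rfl) <;>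
      simp [inf_neg, inf_comm (neg _)]
  sup_mem := by
    rintro x (rfl | rfl | rfl | rfl) y (rfl | rfl | rfl | rfl) <;>
      simp [sup_neg, sup_comm (neg _)]
  neg_mem := by
    rintro x (rfl | rfl | rfl | rfl) <;> simp [neg_bot, neg_top, neg_neg]
  distrib := by
    rintro x (rfl | rfl | rfl | rfl) y (rfl | rfl | rfl | rfl) z (rfl | rfl | rfl | rfl) <;>
      simp [sup_neg, inf_neg, inf_comm (neg _), sup_comm (neg _)]

end OML

theorem GenSub.mono {α : Type u} [OML α] {X Y : Set α} (h : X ⊆ Y) {x : α} (hx : GenSub X x) :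
    GenSub Y x := by
  induction hx with
  | base x hx => exact .base x (h hx)
  | inf x y _ _ ihx ihy => exact .inf x y ihx ihy
  | sup x y _ _ ihx ihy => exact .sup x y ihx ihy

theorem IsBoolHomOn.mono {α : Type u} [OML α] {S T : Set α} (h : S ⊆ T) {v : α → Bool}
    (hv : IsBoolHomOn T v) : IsBoolHomOn S v :=
  ⟨hv.1, hv.2.1, fun x hx y hy => hv.2.2.1 x (h hx) y (h hy),
    fun x hx y hy => hv.2.2.2.1 x (h hx) y (h hy), fun x hx => hv.2.2.2.2 x (h hx)⟩

theorem PossSpace.isCentral {α : Type u} {β : Type v} [OML α] [OML β] {e : α → β} {dia : β → β}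
    (hdia : IsDiamond dia) {x : β} (hx : x ∈ PossSpace e dia) : OML.IsCentral x := by
  refine OML.Splits.isCentral ?_
  induction hx with
  | base x hx =>
    obtain ⟨q, rfl⟩ := hx
    exact (hdia (e q)).1.1.splits
  | inf x y _ _ ihx ihy => exact ihx.inf ihy
  | sup x y _ _ ihx ihy => exact ihx.sup ihy

/-- **Proposition 3.5.** The classical consequences of `p` are
exactly the elements of `◇L` above `p`, equivalently those above `◇p`. -/
theorem classical_consequences_eq {α : Type u} {β : Type v} [OML α] [OML β]
    (dia : β → β) (hdia : IsDiamond dia)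
    (e : α → β) (he : IsOMLEmbedding e) (p : α) :
    {x : β | x ∈ PossSpace e dia ∧
        ∀ W : Set α, IsBooleanSub W → p ∈ W →
          ∀ v : β → Bool,
            IsBoolHomOn {y : β | GenSub ((e '' W) ∪ Set.range fun q : α => dia (e q)) y} v →
            v (e p) = true → v x = true}
      = {x : β | x ∈ PossSpace e dia ∧ e p ≤ x} ∧
    {x : β | x ∈ PossSpace e dia ∧ e p ≤ x}
      = {x : β | x ∈ PossSpace e dia ∧ dia (e p) ≤ x} := by
  refine ⟨Set.ext fun x => and_congr_right fun hx =>
      ⟨fun hcons => ?_, fun hpx W _ hpW v hv hvp => ?_⟩,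
    Set.ext fun x => and_congr_right fun hx => ⟨fun hpx => ?_, fun hpx => ?_⟩⟩
  · by_contra hpx
    obtain ⟨v, hv, hvp, hvx⟩ := OML.exists_valuation hpx
    have hvx' := hcons {⊥, ⊤, p, OML.neg p} (OML.isBooleanSub_four p) (by simp) v
      (hv.mono fun y hy => ?_) hvp
    · simp [hvx] at hvx'
    · change OML.CentralBelow (e p) y
      obtain ⟨-, hbot, htop, -, -, hneg⟩ := he
      induction hy with
      | base y hy =>
        rcases hy with ⟨q, rfl | rfl | rfl | rfl, rfl⟩ | ⟨q, rfl⟩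
        · rw [hbot, ← OML.neg_top]; exact OML.splits_top.neg.centralBelow _
        · rw [htop]; exact OML.splits_top.centralBelow _
        · exact OML.centralBelow_self _
        · rw [hneg]; exact (OML.centralBelow_self _).neg
        · exact (hdia (e q)).1.1.splits.centralBelow _
      | inf y w _ _ ihy ihw => exact ihy.inf ihw
      | sup y w _ _ ihy ihw => exact ihy.sup ihw
  · have h := hv.2.2.1 (e p) (.base _ (.inl ⟨p, hpW, rfl⟩)) x (hx.mono Set.subset_union_right)
    rw [inf_eq_left.2 hpx, hvp] at h
    simpa using h.symm
  · exact (hdia (e p)).2 ⟨PossSpace.isCentral hdia hx, hpx⟩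
  · exact (hdia (e p)).1.2.trans hpx
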